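/- Let n be a finite index type, N ≥ 1, z_1, …, z_N ∈ ℝ^n, let p0 : ℝ → ℝ be twice differentiable and strictly positive, and let Σ : ℝ × ℝ → Matrix n n ℝ and μ : ℝ × ℝ → ℝ^n be twice continuously differentiable near (t₀,s₀), with Σ(t,s) symmetric for all (t,s) and Σ(t₀,s₀) positive definite. Write d_j = z_j − μ(t₀,s₀), q_j = d_j ⬝ᵥ Σ⁻¹.mulVec d_j, W(u) = p0'(u)/p0(u), first partials μ_t, μ_s, Σ_t, Σ_s, mixed second partials μ_{ts}, Σ_{ts}, Σ^{(t)} = −Σ⁻¹Σ_tΣ⁻¹, Σ^{(s)} = −Σ⁻¹Σ_sΣ⁻¹, and let Σ^{(ts)} be the mixed second partial of (t,s) ↦ Σ(t,s)⁻¹ at (t₀,s₀). Then the negative mixed second partial derivative of the log-likelihood ℓ(t,s) = −(N/2) log det Σ(t,s) + Σ_{j} log p0((z_j−μ(t,s)) ⬝ᵥ Σ(t,s)⁻¹.mulVec (z_j−μ(t,s))) at (t₀,s₀) equals (N/2)·[trace(Σ^{(t)}Σ_s) + trace(Σ⁻¹Σ_{ts})] − Σ_{j=1}^N { W'(q_j)·(d_j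 ⬝ᵥ Σ^{(t)}.mulVec d_j − 2 μ_t ⬝ᵥ Σ⁻¹.mulVec d_j)·(d_j ⬝ᵥ Σ^{(s)}.mulVec d_j − 2 μ_s ⬝ᵥ Σ⁻¹.mulVec d_j) + W(q_j)·(d_j ⬝ᵥ Σ^{(ts)}.mulVec d_j − 2 μ_t ⬝ᵥ Σ^{(s)}.mulVec d_j − 2 μ_s ⬝ᵥ Σ^{(t)}.mulVec d_j − 2 μ_{ts} ⬝ᵥ Σ⁻¹.mulVec d_j + 2 μ_t ⬝ᵥ Σ⁻¹.mulVec μ_s) }. -/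

import Mathlib

open Matrix

attribute [local instance] Matrix.normedAddCommGroup Matrix.normedSpace

open Filter Topology

section MatrixCalculus

variable {n : Type*} [Fintype n]

theorem Matrix.hasDerivAt_iff {M : ℝ → Matrix n n ℝ} {M' : Matrix n n ℝ} {x : ℝ} :
    HasDerivAt M M' x ↔ ∀ i j, HasDerivAt (fun y => M y i j) (M' i j) x := by
  refine Iff.trans (hasDerivAt_pi (φ := M) (φ' := M')) (forall_congr' fun i => ?_)
  exact hasDerivAt_pi (φ := fun y => M y i) (φ' := M' i)

theorem HasDerivAt.matrix_dotProduct {u v : ℝ → n → ℝ} {u' v' : n → ℝ} {x : ℝ}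
    (hu : HasDerivAt u u' x) (hv : HasDerivAt v v' x) :
    HasDerivAt (fun y => u y ⬝ᵥ v y) (u' ⬝ᵥ v x + u x ⬝ᵥ v') x := by
  simp only [dotProduct, ← Finset.sum_add_distrib]
  exact HasDerivAt.fun_sum fun i _ => (hasDerivAt_pi.1 hu i).mul (hasDerivAt_pi.1 hv i)

theorem HasDerivAt.matrix_mulVec {M : ℝ → Matrix n n ℝ} {M' : Matrix n n ℝ}
    {v : ℝ → n → ℝ} {v' : n → ℝ} {x : ℝ}
    (hM : HasDerivAt M M' x) (hv : HasDerivAt v v' x) :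
    HasDerivAt (fun y => M y *ᵥ v y) (M' *ᵥ v x + M x *ᵥ v') x :=
  hasDerivAt_pi.2 fun i =>
    HasDerivAt.matrix_dotProduct (hasDerivAt_pi.2 (Matrix.hasDerivAt_iff.1 hM i)) hv

theorem HasDerivAt.matrix_mul {A B : ℝ → Matrix n n ℝ} {A' B' : Matrix n n ℝ} {x : ℝ}
    (hA : HasDerivAt A A' x) (hB : HasDerivAt B B' x) :
    HasDerivAt (fun y => A y * B y) (A' * B x + A x * B') x :=
  Matrix.hasDerivAt_iff.2 fun i j =>
    HasDerivAt.matrix_dotProduct (hasDerivAt_pi.2 (Matrix.hasDerivAt_iff.1 hA i))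
      (hasDerivAt_pi.2 fun k => Matrix.hasDerivAt_iff.1 hB k j)

theorem HasDerivAt.matrix_trace {A : ℝ → Matrix n n ℝ} {A' : Matrix n n ℝ} {x : ℝ}
    (hA : HasDerivAt A A' x) : HasDerivAt (fun y => (A y).trace) A'.trace x :=
  HasDerivAt.fun_sum fun i _ => Matrix.hasDerivAt_iff.1 hA i i

theorem HasDerivAt.matrix_isSymm {A : ℝ → Matrix n n ℝ} {A' : Matrix n n ℝ} {x : ℝ}
    (hA : HasDerivAt A A' x) (hsym : ∀ y, (A y).IsSymm) : A'.IsSymm := by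
  ext i j
  have h := Matrix.hasDerivAt_iff.1 hA
  refine (h j i).unique ?_
  simpa only [(hsym _).apply i j] using h i j

theorem Matrix.IsSymm.dotProduct_mulVec_comm {A : Matrix n n ℝ} (hA : A.IsSymm) (u v : n → ℝ) :
    u ⬝ᵥ A *ᵥ v = v ⬝ᵥ A *ᵥ u := by
  rw [dotProduct_mulVec, ← mulVec_transpose, hA, dotProduct_comm]

theorem HasDerivAt.matrix_bilin {u v : ℝ → n → ℝ} {u' v' : n → ℝ} {A : ℝ → Matrix n n ℝ}
    {A' : Matrix n n ℝ} {x : ℝ} (hu : HasDerivAt u u' x) (hA : HasDerivAt A A' x)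
    (hv : HasDerivAt v v' x) :
    HasDerivAt (fun y => u y ⬝ᵥ A y *ᵥ v y)
      (u' ⬝ᵥ A x *ᵥ v x + u x ⬝ᵥ A' *ᵥ v x + u x ⬝ᵥ A x *ᵥ v') x := by
  have h := hu.matrix_dotProduct (hA.matrix_mulVec hv)
  rwa [dotProduct_add, ← add_assoc] at h

/-- Derivative of the quadratic form `(z - m)ᵀ A (z - m)` along a curve of symmetric matrices. -/
theorem HasDerivAt.matrix_quadForm_sub {m : ℝ → n → ℝ} {m' : n → ℝ} {A : ℝ → Matrix n n ℝ}
    {A' : Matrix n n ℝ} {x : ℝ} (z : n → ℝ) (hm : HasDerivAt m m' x) (hA : HasDerivAt A A' x)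
    (hsym : (A x).IsSymm) :
    HasDerivAt (fun y => (z - m y) ⬝ᵥ A y *ᵥ (z - m y))
      ((z - m x) ⬝ᵥ A' *ᵥ (z - m x) - 2 * (m' ⬝ᵥ A x *ᵥ (z - m x))) x := by
  have hz : HasDerivAt (fun y => z - m y) (-m') x := hm.const_sub z
  convert hz.matrix_bilin hA hz using 1
  rw [hsym.dotProduct_mulVec_comm (z - m x) (-m'), neg_dotProduct]
  ring

theorem Matrix.contDiff_apply (i j : n) {k : WithTop ℕ∞} :
    ContDiff ℝ k (fun A : Matrix n n ℝ => A i j) :=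
  contDiff_apply_apply ℝ ℝ i j

variable [DecidableEq n]

theorem contDiff_matrix_det {E : Type*} [NormedAddCommGroup E] [NormedSpace ℝ E]
    {k : WithTop ℕ∞} {M : E → Matrix n n ℝ} (hM : ∀ i j, ContDiff ℝ k (fun x => M x i j)) :
    ContDiff ℝ k (fun x => (M x).det) := by
  simp only [Matrix.det_apply']
  exact ContDiff.sum fun σ _ => contDiff_const.mul (contDiff_prod fun i _ => hM _ _)

theorem Matrix.contDiffAt_inv {A : Matrix n n ℝ} (hA : A.det ≠ 0) {k : WithTop ℕ∞} :
    ContDiffAt ℝ k (fun B : Matrix n n ℝ => B⁻¹) A := by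
  have hdet : ContDiff ℝ k (fun B : Matrix n n ℝ => B.det) :=
    contDiff_matrix_det fun i j => Matrix.contDiff_apply i j
  refine contDiffAt_pi.2 fun i => contDiffAt_pi.2 fun j => ?_
  simp only [Matrix.inv_def, Matrix.smul_apply, Ring.inverse_eq_inv', smul_eq_mul,
    Matrix.adjugate_apply]
  refine (hdet.contDiffAt.inv hA).mul (ContDiff.contDiffAt (contDiff_matrix_det fun a b => ?_))
  simp only [Matrix.updateRow_apply]
  split_ifs
  · exact contDiff_const
  · exact Matrix.contDiff_apply a b

/-- Jacobi's formula at an invertible matrix. -/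
theorem HasDerivAt.matrix_det {M : ℝ → Matrix n n ℝ} {M' : Matrix n n ℝ} {x : ℝ}
    (hM : HasDerivAt M M' x) (hdet : (M x).det ≠ 0) :
    HasDerivAt (fun y => (M y).det) ((M x).det * ((M x)⁻¹ * M').trace) x := by
  have hD : DifferentiableAt ℝ (fun B : Matrix n n ℝ => B.det) (M x) :=
    (contDiff_matrix_det fun i j => Matrix.contDiff_apply i j).differentiable one_ne_zero _
  have hchain := hD.hasFDerivAt.comp_hasDerivAt x hM
  have hline : HasDerivAt (fun r : ℝ => M x + r • M') M' 0 := by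
    refine Matrix.hasDerivAt_iff.2 fun i j => ?_
    simpa using ((hasDerivAt_id (0 : ℝ)).mul_const (M' i j)).const_add (M x i j)
  have hline_det := HasFDerivAt.comp_hasDerivAt (l := fun B : Matrix n n ℝ => B.det)
    (0 : ℝ) (by rw [zero_smul, add_zero]; exact hD.hasFDerivAt) hline
  set p := (1 + (Polynomial.X : Polynomial ℝ) •
    ((M x)⁻¹ * M').map Polynomial.C).det.divX.divX
  have hexpand (r : ℝ) : (M x + r • M').det =
      (M x).det * (1 + ((M x)⁻¹ * M').trace * r + p.eval r * r ^ 2) := by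
    rw [← Matrix.det_one_add_smul, ← Matrix.det_mul, mul_add, mul_one, Matrix.mul_smul,
      ← mul_assoc, Matrix.mul_nonsing_inv _ (isUnit_iff_ne_zero.2 hdet), one_mul]
  have hpoly : HasDerivAt (fun r : ℝ => (M x + r • M').det)
      ((M x).det * ((M x)⁻¹ * M').trace) 0 := by
    simp only [hexpand]
    refine HasDerivAt.const_mul _ ?_
    have h := (((hasDerivAt_id (0 : ℝ)).const_mul ((M x)⁻¹ * M').trace).const_add 1).add
      ((p.hasDerivAt 0).mul ((hasDerivAt_id (0 : ℝ)).pow 2))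
    refine h.congr_deriv ?_
    simp
  rw [← hline_det.unique hpoly]
  exact hchain

theorem HasDerivAt.log_matrix_det {M : ℝ → Matrix n n ℝ} {M' : Matrix n n ℝ} {x : ℝ}
    (hM : HasDerivAt M M' x) (hdet : (M x).det ≠ 0) :
    HasDerivAt (fun y => Real.log (M y).det) ((M x)⁻¹ * M').trace x := by
  convert (hM.matrix_det hdet).log hdet using 1
  field_simp

theorem HasDerivAt.matrix_inv {M : ℝ → Matrix n n ℝ} {M' : Matrix n n ℝ} {x : ℝ}
    (hM : HasDerivAt M M' x) (hdet : (M x).det ≠ 0) :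
    HasDerivAt (fun y => (M y)⁻¹) (-((M x)⁻¹ * M' * (M x)⁻¹)) x := by
  have hI : DifferentiableAt ℝ (fun y => (M y)⁻¹) x :=
    DifferentiableAt.comp (g := fun B : Matrix n n ℝ => B⁻¹) x
      ((Matrix.contDiffAt_inv (k := 1) hdet).differentiableAt one_ne_zero) hM.differentiableAt
  obtain ⟨I', hI'⟩ : ∃ I', HasDerivAt (fun y => (M y)⁻¹) I' x := ⟨_, hI.hasDerivAt⟩
  have hne : ∀ᶠ y in 𝓝 x, (M y).det ≠ 0 :=
    (hM.matrix_det hdet).continuousAt.eventually_ne hdet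
  have hone : (fun y => (M y)⁻¹ * M y) =ᶠ[𝓝 x] fun _ => (1 : Matrix n n ℝ) :=
    hne.mono fun y hy => Matrix.nonsing_inv_mul _ (isUnit_iff_ne_zero.2 hy)
  have hzero : I' * M x + (M x)⁻¹ * M' = 0 :=
    (hI'.matrix_mul hM).unique ((hasDerivAt_const x (1 : Matrix n n ℝ)).congr_of_eventuallyEq hone)
  have hI'_eq : I' = -((M x)⁻¹ * M' * (M x)⁻¹) := by
    rw [← neg_mul, ← eq_neg_of_add_eq_zero_left hzero, mul_assoc,
      Matrix.mul_nonsing_inv _ (isUnit_iff_ne_zero.2 hdet), mul_one]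
  exact hI'_eq ▸ hI'

end MatrixCalculus

section PartialDerivatives

variable {E : Type*} [NormedAddCommGroup E] [NormedSpace ℝ E] {f : ℝ × ℝ → E} {t₀ s₀ : ℝ}

theorem DifferentiableAt.hasDerivAt_snd {t : ℝ} (hf : DifferentiableAt ℝ f (t, s₀)) :
    HasDerivAt (fun s => f (t, s)) (fderiv ℝ f (t, s₀) (0, 1)) s₀ :=
  hf.hasFDerivAt.comp_hasDerivAt s₀ ((hasDerivAt_const s₀ t).prodMk (hasDerivAt_id s₀))

theorem ContDiffAt.hasDerivAt_fst (hf : ContDiffAt ℝ 2 f (t₀, s₀)) :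
    HasDerivAt (fun t => f (t, s₀)) (deriv (fun t => f (t, s₀)) t₀) t₀ :=
  (DifferentiableAt.comp (g := f) t₀ (hf.differentiableAt two_ne_zero)
    (differentiableAt_id.prodMk (differentiableAt_const s₀))).hasDerivAt

theorem ContDiffAt.eventually_differentiableAt_fst (hf : ContDiffAt ℝ 2 f (t₀, s₀)) :
    ∀ᶠ t in 𝓝 t₀, DifferentiableAt ℝ f (t, s₀) := by
  have hc : ContinuousAt (fun t : ℝ => (t, s₀)) t₀ := by fun_prop
  exact hc.eventually ((hf.eventually (by simp)).mono fun p hp => hp.differentiableAt two_ne_zero)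

theorem ContDiffAt.eventually_hasDerivAt_snd (hf : ContDiffAt ℝ 2 f (t₀, s₀)) :
    ∀ᶠ t in 𝓝 t₀, HasDerivAt (fun s => f (t, s)) (deriv (fun s => f (t, s)) s₀) s₀ :=
  hf.eventually_differentiableAt_fst.mono fun _ ht =>
    ht.hasDerivAt_snd.differentiableAt.hasDerivAt

theorem ContDiffAt.hasDerivAt_deriv_snd (hf : ContDiffAt ℝ 2 f (t₀, s₀)) :
    HasDerivAt (fun t => deriv (fun s => f (t, s)) s₀)
      (deriv (fun t => deriv (fun s => f (t, s)) s₀) t₀) t₀ := by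
  have hD : DifferentiableAt ℝ (fderiv ℝ f) (t₀, s₀) :=
    (hf.fderiv_right (m := 1) (by norm_num)).differentiableAt one_ne_zero
  have hD' : DifferentiableAt ℝ (fun t => fderiv ℝ f (t, s₀)) t₀ :=
    DifferentiableAt.comp (g := fderiv ℝ f) t₀ hD
      (differentiableAt_id.prodMk (differentiableAt_const s₀))
  have heq : (fun t => deriv (fun s => f (t, s)) s₀) =ᶠ[𝓝 t₀]
      fun t => fderiv ℝ f (t, s₀) (0, 1) :=
    hf.eventually_differentiableAt_fst.mono fun _ ht => ht.hasDerivAt_snd.deriv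
  exact ((hD'.clm_apply (differentiableAt_const _)).congr_of_eventuallyEq heq).hasDerivAt

end PartialDerivatives

/-- The `(i,i')` entry `J_{(k)ii'}` of the observed information matrix of the elliptical
errors-in-variables model: the negative mixed second partial derivative of
`ℓ(t,s) = −(N/2) log det Σ(t,s) + Σ_j log p0(d_j(t,s)ᵀ Σ(t,s)⁻¹ d_j(t,s))`
(Appendix A of the paper). -/
theorem stmt_8 {n : Type*} [Fintype n] [DecidableEq n] (N : ℕ) (hN : 1 ≤ N)
    (z : Fin N → n → ℝ) (p0 : ℝ → ℝ)
    (hp0 : Differentiable ℝ p0) (hp0' : Differentiable ℝ (deriv p0))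
    (hp0pos : ∀ u, 0 < p0 u)
    (S : ℝ × ℝ → Matrix n n ℝ) (μ : ℝ × ℝ → n → ℝ) (t₀ s₀ : ℝ)
    (hS : ContDiffAt ℝ 2 S (t₀, s₀)) (hμ : ContDiffAt ℝ 2 μ (t₀, s₀))
    (hsym : ∀ ts : ℝ × ℝ, (S ts).IsSymm)
    (hpd : (S (t₀, s₀)).PosDef)
    (W : ℝ → ℝ) (hW : W = fun u => deriv p0 u / p0 u)
    (d : Fin N → n → ℝ) (hd : ∀ j, d j = z j - μ (t₀, s₀))
    (q : Fin N → ℝ) (hq : ∀ j, q j = d j ⬝ᵥ (S (t₀, s₀))⁻¹.mulVec (d j))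
    (μt μs μts : n → ℝ)
    (hμt : μt = deriv (fun t => μ (t, s₀)) t₀)
    (hμs : μs = deriv (fun s => μ (t₀, s)) s₀)
    (hμts : μts = deriv (fun t => deriv (fun s => μ (t, s)) s₀) t₀)
    (St Ss Sts : Matrix n n ℝ)
    (hSt : St = deriv (fun t => S (t, s₀)) t₀)
    (hSs : Ss = deriv (fun s => S (t₀, s)) s₀)
    (hSts : Sts = deriv (fun t => deriv (fun s => S (t, s)) s₀) t₀)
    (Sinvt Sinvs Sinvts : Matrix n n ℝ)
    (hSinvt : Sinvt = -((S (t₀, s₀))⁻¹ * St * (S (t₀, s₀))⁻¹))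
    (hSinvs : Sinvs = -((S (t₀, s₀))⁻¹ * Ss * (S (t₀, s₀))⁻¹))
    (hSinvts : Sinvts = deriv (fun t => deriv (fun s => (S (t, s))⁻¹) s₀) t₀) :
    -(deriv (fun t => deriv
        (fun s => -(N / 2 : ℝ) * Real.log (S (t, s)).det +
          ∑ j, Real.log
            (p0 ((z j - μ (t, s)) ⬝ᵥ (S (t, s))⁻¹.mulVec (z j - μ (t, s))))) s₀) t₀)
      = (N / 2 : ℝ) * ((Sinvt * Ss).trace + ((S (t₀, s₀))⁻¹ * Sts).trace)
        - ∑ j,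
          (deriv W (q j) *
              (d j ⬝ᵥ Sinvt.mulVec (d j) - 2 * (μt ⬝ᵥ (S (t₀, s₀))⁻¹.mulVec (d j))) *
              (d j ⬝ᵥ Sinvs.mulVec (d j) - 2 * (μs ⬝ᵥ (S (t₀, s₀))⁻¹.mulVec (d j)))
            + W (q j) *
              (d j ⬝ᵥ Sinvts.mulVec (d j) - 2 * (μt ⬝ᵥ Sinvs.mulVec (d j))
                - 2 * (μs ⬝ᵥ Sinvt.mulVec (d j))
                - 2 * (μts ⬝ᵥ (S (t₀, s₀))⁻¹.mulVec (d j))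
                + 2 * (μt ⬝ᵥ (S (t₀, s₀))⁻¹.mulVec μs))) := by
  have hdet : (S (t₀, s₀)).det ≠ 0 := hpd.det_pos.ne'
  have hI : ContDiffAt ℝ 2 (fun p => (S p)⁻¹) (t₀, s₀) :=
    ContDiffAt.comp (g := fun B : Matrix n n ℝ => B⁻¹) _ (Matrix.contDiffAt_inv hdet) hS
  have hIsym (p : ℝ × ℝ) : ((S p)⁻¹).IsSymm := (hsym p).inv
  have hlogp (u : ℝ) : HasDerivAt (fun u => Real.log (p0 u)) (W u) u := by
    rw [hW]
    exact (hp0 u).hasDerivAt.log (hp0pos u).ne'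
  have hWd (u : ℝ) : HasDerivAt W (deriv W u) u := by
    rw [hW]
    exact ((hp0' u).div (hp0 u) (hp0pos u).ne').hasDerivAt
  have hS_t : HasDerivAt (fun t => S (t, s₀)) St t₀ := hSt ▸ hS.hasDerivAt_fst
  have hS_ts : HasDerivAt (fun t => deriv (fun s => S (t, s)) s₀) Sts t₀ :=
    hSts ▸ hS.hasDerivAt_deriv_snd
  have hI_ts : HasDerivAt (fun t => deriv (fun s => (S (t, s))⁻¹) s₀) Sinvts t₀ :=
    hSinvts ▸ hI.hasDerivAt_deriv_snd
  have hμ_t := hμ.hasDerivAt_fst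
  have hI_t : HasDerivAt (fun t => (S (t, s₀))⁻¹) Sinvt t₀ := by
    rw [hSinvt]
    exact hS_t.matrix_inv hdet
  have hI_s : deriv (fun s => (S (t₀, s))⁻¹) s₀ = Sinvs := by
    rw [hSinvs, hSs]
    exact (hS.eventually_hasDerivAt_snd.self_of_nhds.matrix_inv hdet).deriv
  have hSinvs_symm : Sinvs.IsSymm := hI_s ▸
    (hI.eventually_hasDerivAt_snd.self_of_nhds.matrix_isSymm fun s => hIsym (t₀, s))
  have hinner : (fun t => deriv (fun s => -(N / 2 : ℝ) * Real.log (S (t, s)).det +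
      ∑ j, Real.log (p0 ((z j - μ (t, s)) ⬝ᵥ (S (t, s))⁻¹.mulVec (z j - μ (t, s))))) s₀)
      =ᶠ[𝓝 t₀] fun t =>
        -(N / 2 : ℝ) * ((S (t, s₀))⁻¹ * deriv (fun s => S (t, s)) s₀).trace +
        ∑ j, W ((z j - μ (t, s₀)) ⬝ᵥ (S (t, s₀))⁻¹ *ᵥ (z j - μ (t, s₀))) *
          ((z j - μ (t, s₀)) ⬝ᵥ deriv (fun s => (S (t, s))⁻¹) s₀ *ᵥ (z j - μ (t, s₀)) -
            2 * (deriv (fun s => μ (t, s)) s₀ ⬝ᵥ (S (t, s₀))⁻¹ *ᵥ (z j - μ (t, s₀)))) := by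
    filter_upwards [hS.eventually_hasDerivAt_snd, hμ.eventually_hasDerivAt_snd,
      hI.eventually_hasDerivAt_snd, (hS_t.matrix_det hdet).continuousAt.eventually_ne hdet]
      with t hSt' hμt' hIt' hne
    refine HasDerivAt.deriv (HasDerivAt.add ((hSt'.log_matrix_det hne).const_mul _)
      (HasDerivAt.fun_sum fun j _ => ?_))
    exact (hlogp _).comp s₀ (hμt'.matrix_quadForm_sub (z j) hIt' (hIsym (t, s₀)))
  have hterm (j : Fin N) : HasDerivAt (fun t =>
      W ((z j - μ (t, s₀)) ⬝ᵥ (S (t, s₀))⁻¹ *ᵥ (z j - μ (t, s₀))) *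
          ((z j - μ (t, s₀)) ⬝ᵥ deriv (fun s => (S (t, s))⁻¹) s₀ *ᵥ (z j - μ (t, s₀)) -
            2 * (deriv (fun s => μ (t, s)) s₀ ⬝ᵥ (S (t, s₀))⁻¹ *ᵥ (z j - μ (t, s₀)))))
      (deriv W (q j) *
              (d j ⬝ᵥ Sinvt.mulVec (d j) - 2 * (μt ⬝ᵥ (S (t₀, s₀))⁻¹.mulVec (d j))) *
              (d j ⬝ᵥ Sinvs.mulVec (d j) - 2 * (μs ⬝ᵥ (S (t₀, s₀))⁻¹.mulVec (d j)))
            + W (q j) *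
              (d j ⬝ᵥ Sinvts.mulVec (d j) - 2 * (μt ⬝ᵥ Sinvs.mulVec (d j))
                - 2 * (μs ⬝ᵥ Sinvt.mulVec (d j))
                - 2 * (μts ⬝ᵥ (S (t₀, s₀))⁻¹.mulVec (d j))
                + 2 * (μt ⬝ᵥ (S (t₀, s₀))⁻¹.mulVec μs))) t₀ := by
    have hWq := (hWd _).comp t₀ (hμ_t.matrix_quadForm_sub (z j) hI_t (hIsym (t₀, s₀)))
    have hquad := hμ_t.matrix_quadForm_sub (z j) hI_ts
      (by rw [hI_s]; exact hSinvs_symm)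
    have hlin := hμ.hasDerivAt_deriv_snd.matrix_bilin hI_t (hμ_t.const_sub (z j))
    refine (hWq.mul (hquad.sub (hlin.const_mul 2))).congr_deriv ?_
    simp only [Function.comp_apply, Pi.sub_apply]
    rw [hI_s, ← hμs, ← hμt, ← hμts, ← hd, ← hq, Matrix.mulVec_neg, dotProduct_neg,
      (hIsym (t₀, s₀)).dotProduct_mulVec_comm μt μs]
    ring
  have htrace := (hI_t.matrix_mul hS_ts).matrix_trace
  have htotal := (htrace.const_mul (-(N / 2 : ℝ))).add
    (HasDerivAt.fun_sum (u := Finset.univ) fun j _ => hterm j)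
  rw [hinner.deriv_eq]
  refine (congrArg Neg.neg htotal.deriv).trans ?_
  rw [← hSs, Matrix.trace_add]
  ring
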